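/- For all positive reals x1, x2, x3, x4 with x1+x2+x3+x4 = 1, one has 1/x1 + 1/x2 + 1/x3 + 1/x4 ≥ λ4 / (1 + 16(λ4 - 16)·x1x2x3x4), where λ4 = (582√97 - 2054)/121. -/

import Mathlib

/-- The polynomial form of the inequality, with `c = λ - 16`. -/
def FF (c x y z w : ℝ) : ℝ :=
  (x * y * (z + w) + z * w * (x + y)) * (1 + 16 * c * (x * y * z * w)) - (c + 16) * (x * y * z * w)

lemma FF_31 (c a b : ℝ) (hs : a + a + a + b = 1)
    (hg : 0 ≤ 3 - c * a - 5 * c * a ^ 2 + 24 * c * a ^ 3) : 0 ≤ FF c a a a b := by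
  have hb : b = 1 - 3 * a := by linarith
  have : FF c a a a b =
      a ^ 2 * (1 - 4 * a) ^ 2 * (3 - c * a - 5 * c * a ^ 2 + 24 * c * a ^ 3) := by
    subst hb; unfold FF; ring
  rw [this]; positivity

lemma FF_22 (c a b : ℝ) (ha : 0 < a) (hb : 0 < b) (hs : a + a + b + b = 1)
    (hc0 : 0 < c) (hc : c ≤ 16) : 0 ≤ FF c a a b b := by
  have hb' : b = 1 / 2 - a := by linarith
  have hq : a * b ≤ 1 / 16 := by subst hb'; nlinarith [sq_nonneg (a - 1 / 4)]
  have hab : 0 < a * b := mul_pos ha hb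
  have : FF c a a b b = (a * b) * ((1 - 16 * (a * b)) * (1 - c * (a * b))) := by
    subst hb'; unfold FF; ring
  rw [this]
  have h1 : c * (a * b) ≤ 1 := by nlinarith
  have h2 : 0 ≤ 1 - 16 * (a * b) := by linarith
  have h3 : 0 ≤ 1 - c * (a * b) := by linarith
  positivity

/-- Minimality over the closed simplex. -/
def IsMinPt (c x y z w : ℝ) : Prop :=
  ∀ a b d e : ℝ, 0 ≤ a → 0 ≤ b → 0 ≤ d → 0 ≤ e → a + b + d + e = 1 → FF c x y z w ≤ FF c a b d e

lemma crit (c x y z w : ℝ) (hx : 0 < x) (hy : 0 < y) (hz : 0 < z) (hw : 0 < w)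
    (hs : x + y + z + w = 1) (hm : IsMinPt c x y z w) (hxy : x ≠ y) :
    (z + w) * (1 + 16 * c * (x * y * z * w)) =
      (c + 16 - 16 * c * (x * y * (z + w) + z * w * (x + y))) * (z * w) := by
  -- the restriction to the segment is a quadratic in `p = (x+t)(y-t)`
  have key : HasDerivAt (fun t : ℝ => FF c (x + t) (y - t) z w)
      ((y - x) * (2 * (16 * c * (z + w) * (z * w)) * (x * y)
        + ((z + w) + 16 * c * (z * w) ^ 2 * (x + y) - (c + 16) * (z * w)))) 0 := by
    have hp : HasDerivAt (fun t : ℝ => (x + t) * (y - t)) (y - x) 0 := by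
      have h1 : HasDerivAt (fun t : ℝ => x + t) 1 0 := (hasDerivAt_id (0:ℝ)).const_add x
      have h2 : HasDerivAt (fun t : ℝ => y - t) (-1) 0 := (hasDerivAt_id (0:ℝ)).const_sub y
      have h3 := h1.mul h2
      exact h3.congr_deriv (by ring)
    have h4 := (((hp.mul hp).const_mul (16 * c * (z + w) * (z * w))).add
      (hp.const_mul ((z + w) + 16 * c * (z * w) ^ 2 * (x + y) - (c + 16) * (z * w)))).add_const
        (z * w * (x + y))
    refine (h4.congr_deriv (by ring)).congr_of_eventuallyEq (Filter.Eventually.of_forall ?_)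
    intro t
    simp only [Pi.add_apply, Pi.mul_apply]
    unfold FF; ring
  have hloc : IsLocalMin (fun t : ℝ => FF c (x + t) (y - t) z w) 0 := by
    have h1 : ∀ᶠ t : ℝ in nhds 0, -x < t := lt_mem_nhds (by linarith)
    have h2 : ∀ᶠ t : ℝ in nhds 0, t < y := gt_mem_nhds hy
    filter_upwards [h1, h2] with t ht1 ht2
    simp only [add_zero, sub_zero]
    exact hm _ _ _ _ (by linarith) (by linarith) hz.le hw.le (by linarith)
  have h0 := hloc.hasDerivAt_eq_zero key
  rcases mul_eq_zero.1 h0 with h | h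
  · exact absurd (by linarith) hxy
  · linear_combination h

/-- Cancelling in the critical equations. -/
lemma cancel (u K y z w : ℝ) (hw : 0 < w) (hu : 0 < u)
    (h1 : (z + w) * u = K * (z * w)) (h2 : (y + w) * u = K * (y * w)) : y = z := by
  have : w * u * (y - z) = 0 := by linear_combination y * h1 - z * h2
  rcases mul_eq_zero.1 this with h | h
  · exact absurd h (by positivity)
  · linarith

/-- Among the first three coordinates of a minimum point two coincide. -/
lemma two_eq (c x y z w : ℝ) (hc0 : 0 < c) (hx : 0 < x) (hy : 0 < y) (hz : 0 < z) (hw : 0 < w)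
    (hs : x + y + z + w = 1) (hm : IsMinPt c x y z w) : x = y ∨ x = z ∨ y = z := by
  by_cases hxy : x = y
  · exact Or.inl hxy
  by_cases hxz : x = z
  · exact Or.inr (Or.inl hxz)
  right; right
  have h1 := crit c x y z w hx hy hz hw hs hm hxy
  have hm' : IsMinPt c x z y w := by
    intro a b d e ha hb hd he hh
    have := hm a b d e ha hb hd he hh
    have h : FF c x z y w = FF c x y z w := by unfold FF; ring
    rwa [h]
  have h2 := crit c x z y w hx hz hy hw (by linarith) hm' hxz
  refine cancel (1 + 16 * c * (x * y * z * w))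
    (c + 16 - 16 * c * (x * y * (z + w) + z * w * (x + y))) y z w hw (by positivity) h1 ?_
  linear_combination h2

lemma min_nonneg (c x y z w : ℝ) (hc0 : 0 < c) (hc : c ≤ 16)
    (hg : ∀ a : ℝ, 0 ≤ a → 0 ≤ 3 - c * a - 5 * c * a ^ 2 + 24 * c * a ^ 3)
    (hx : 0 < x) (hy : 0 < y) (hz : 0 < z) (hw : 0 < w)
    (hs : x + y + z + w = 1) (hm : IsMinPt c x y z w) : 0 ≤ FF c x y z w := by
  have perm : ∀ a b d e : ℝ, FF c a b d e = FF c x y z w → IsMinPt c a b d e := by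
    intro a b d e h a' b' d' e' h1 h2 h3 h4 h5
    rw [h]; exact hm a' b' d' e' h1 h2 h3 h4 h5
  have A := two_eq c x y z w hc0 hx hy hz hw hs hm
  have B := two_eq c x y w z hc0 hx hy hw hz (by linarith) (perm _ _ _ _ (by unfold FF; ring))
  have C := two_eq c x z w y hc0 hx hz hw hy (by linarith) (perm _ _ _ _ (by unfold FF; ring))
  have D := two_eq c y z w x hc0 hy hz hw hx (by linarith) (perm _ _ _ _ (by unfold FF; ring))
  have fin : (x = y ∧ y = z) ∨ (x = y ∧ y = w) ∨ (x = z ∧ z = w) ∨ (y = z ∧ z = w) ∨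
      (x = y ∧ z = w) ∨ (x = z ∧ y = w) ∨ (x = w ∧ y = z) := by
    clear hg hm perm
    grind
  rcases fin with ⟨h1, h2⟩ | ⟨h1, h2⟩ | ⟨h1, h2⟩ | ⟨h1, h2⟩ | ⟨h1, h2⟩ | ⟨h1, h2⟩ | ⟨h1, h2⟩
  · have h := FF_31 c x w (by linarith) (hg x hx.le)
    subst h1 h2; exact h
  · have h := FF_31 c x z (by linarith) (hg x hx.le)
    subst h1 h2; convert h using 1; unfold FF; ring
  · have h := FF_31 c x y (by linarith) (hg x hx.le)
    subst h1 h2; convert h using 1; unfold FF; ring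
  · have h := FF_31 c y x (by linarith) (hg y hy.le)
    subst h1 h2; convert h using 1; unfold FF; ring
  · have h := FF_22 c x z hx hz (by linarith) hc0 hc
    subst h1 h2; exact h
  · have h := FF_22 c x y hx hy (by linarith) hc0 hc
    subst h1 h2; convert h using 1; unfold FF; ring
  · have h := FF_22 c x y hx hy (by linarith) hc0 hc
    subst h1 h2; convert h using 1; unfold FF; ring

lemma FF_nonneg (c : ℝ) (hc0 : 0 < c) (hc : c ≤ 16)
    (hg : ∀ a : ℝ, 0 ≤ a → 0 ≤ 3 - c * a - 5 * c * a ^ 2 + 24 * c * a ^ 3)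
    (x y z w : ℝ) (hx : 0 < x) (hy : 0 < y) (hz : 0 < z) (hw : 0 < w)
    (hs : x + y + z + w = 1) : 0 ≤ FF c x y z w := by
  have hK : IsCompact (stdSimplex ℝ (Fin 4)) := isCompact_stdSimplex ℝ (Fin 4)
  have mem : ∀ a b d e : ℝ, 0 ≤ a → 0 ≤ b → 0 ≤ d → 0 ≤ e → a + b + d + e = 1 →
      ![a, b, d, e] ∈ stdSimplex ℝ (Fin 4) := by
    intro a b d e ha hb hd he h
    refine ⟨?_, ?_⟩
    · intro i; fin_cases i <;> simpa
    · simpa [Fin.sum_univ_four] using h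
  have hcont : ContinuousOn (fun v : Fin 4 → ℝ => FF c (v 0) (v 1) (v 2) (v 3))
      (stdSimplex ℝ (Fin 4)) := by
    apply Continuous.continuousOn
    unfold FF; fun_prop
  obtain ⟨v, hv, hmin⟩ := hK.exists_isMinOn
    ⟨_, mem x y z w hx.le hy.le hz.le hw.le hs⟩ hcont
  have hm : IsMinPt c (v 0) (v 1) (v 2) (v 3) := by
    intro a b d e ha hb hd he h
    have := hmin (mem a b d e ha hb hd he h)
    simpa using this
  have h0 : ∀ i, 0 ≤ v i := hv.1
  have hsum : v 0 + v 1 + v 2 + v 3 = 1 := by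
    have := hv.2; rwa [Fin.sum_univ_four] at this
  have hle := hm x y z w hx.le hy.le hz.le hw.le hs
  refine le_trans ?_ hle
  have a0 := h0 0
  have a1 := h0 1
  have a2 := h0 2
  have a3 := h0 3
  by_cases hP : v 0 * v 1 * v 2 * v 3 = 0
  · unfold FF; rw [hP]
    have : 0 ≤ v 0 * v 1 * (v 2 + v 3) + v 2 * v 3 * (v 0 + v 1) := by positivity
    linarith
  · have b0 : v 0 ≠ 0 := by intro h; apply hP; rw [h]; ring
    have b1 : v 1 ≠ 0 := by intro h; apply hP; rw [h]; ring
    have b2 : v 2 ≠ 0 := by intro h; apply hP; rw [h]; ring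
    have b3 : v 3 ≠ 0 := by intro h; apply hP; rw [h]; ring
    exact min_nonneg c _ _ _ _ hc0 hc hg (lt_of_le_of_ne a0 b0.symm) (lt_of_le_of_ne a1 b1.symm)
      (lt_of_le_of_ne a2 b2.symm) (lt_of_le_of_ne a3 b3.symm) hsum hm

theorem stmt_8 (x1 x2 x3 x4 : ℝ) (hx1 : 0 < x1) (hx2 : 0 < x2) (hx3 : 0 < x3) (hx4 : 0 < x4)
    (hsum : x1 + x2 + x3 + x4 = 1) :
    1 / x1 + 1 / x2 + 1 / x3 + 1 / x4 ≥
      ((582 * Real.sqrt 97 - 2054) / 121) /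
        (1 + 16 * ((582 * Real.sqrt 97 - 2054) / 121 - 16) * (x1 * x2 * x3 * x4)) := by
  have hr : Real.sqrt 97 ^ 2 = 97 := Real.sq_sqrt (by norm_num)
  have hr1 : 9.8 < Real.sqrt 97 := by
    apply Real.lt_sqrt_of_sq_lt; norm_num
  have hr2 : Real.sqrt 97 < 9.9 := by
    rw [Real.sqrt_lt' (by norm_num)]; norm_num
  set r := Real.sqrt 97 with hrdef
  clear_value r
  obtain ⟨c, hcdef⟩ : ∃ c : ℝ, c = (582 * r - 2054) / 121 - 16 := ⟨_, rfl⟩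
  have hl : (582 * r - 2054) / 121 = c + 16 := by rw [hcdef]; ring
  have hc0 : 0 < c := by rw [hcdef]; linarith
  have hc : c ≤ 16 := by rw [hcdef]; linarith
  rw [hl]
  have hg : ∀ a : ℝ, 0 ≤ a → 0 ≤ 3 - c * a - 5 * c * a ^ 2 + 24 * c * a ^ 3 := by
    intro a ha
    obtain ⟨s, hsdef⟩ : ∃ s : ℝ, s = (5 + r) / 72 := ⟨_, rfl⟩
    have hs1 : 72 * s ^ 2 = 10 * s + 1 := by
      rw [hsdef]; linear_combination (1 / 72) * hr
    have hs2 : 24 * c * s ^ 2 * (2 * s - 5 / 24) = 3 := by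
      have h2 : r ^ 2 = 97 := hr
      have h3 : r ^ 3 = 97 * r := by linear_combination r * hr
      have h4 : r ^ 4 = 97 ^ 2 := by linear_combination (r ^ 2 + 97) * hr
      rw [hcdef, hsdef]
      ring_nf
      rw [h2, h3, h4]
      ring
    have : 3 - c * a - 5 * c * a ^ 2 + 24 * c * a ^ 3
        = 24 * c * (a - s) ^ 2 * (a + (2 * s - 5 / 24)) := by
      linear_combination (-1) * hs2 + c * a * hs1
    rw [this]
    have : 0 ≤ 2 * s - 5 / 24 := by rw [hsdef]; linarith
    positivity
  have main := FF_nonneg c hc0 hc hg x1 x2 x3 x4 hx1 hx2 hx3 hx4 hsum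
  have e1 : 1 / x1 + 1 / x2 + 1 / x3 + 1 / x4 =
      (x1 * x2 * (x3 + x4) + x3 * x4 * (x1 + x2)) / (x1 * x2 * x3 * x4) := by
    field_simp; ring
  have e2 : c + 16 - 16 = c := by ring
  rw [e1, e2, ge_iff_le, div_le_div_iff₀ (by positivity) (by positivity)]
  unfold FF at main
  linarith
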